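/- (Positivity of the Hessian with a spectral gap.) Assume the Jellium and Wiener conditions. There exists ν > 0 such that for all α ∈ ℝ, r ∈ ℝ³, every N·ℤ³-periodic C¹ function φ : ℝ³ → ℂ with ∫_{T_N} φ(x) dx = 0, every κ : Γ_N → ℝ³ with ∑_{n∈Γ_N} κ(n) = 0, and every p : Γ_N → ℝ³, one has B(φ,κ,p) ≥ ν·( ∫_{T_N}(|φ(x)|² + |∇φ(x)|²) dx + ∑_{n∈Γ_N}|κ(n)|² + ∑_{n∈Γ_N}|p(n)|² ). -/

import Mathlib

noncomputable section

namespace SPN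

open MeasureTheory Finset
open scoped Real

/-- Points of `ℝ³`. -/
abbrev V3 : Type := Fin 3 → ℝ

/-- Euclidean dot product on `ℝ³`. -/
def dotP (v w : V3) : ℝ := ∑ i, v i * w i

/-- Squared Euclidean norm on `ℝ³`. -/
def nsqV (v : V3) : ℝ := ∑ i, v i ^ 2

/-- The fundamental cube `[0,N)³` of the torus `T_N = ℝ³/(N·ℤ³)`. -/
def cubeN (N : ℕ) : Set V3 := {x | ∀ i, x i ∈ Set.Ico (0 : ℝ) (N : ℝ)}

/-- `N·ℤ³`-periodicity of a function on `ℝ³`. -/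
def IsPerN {α : Type*} (N : ℕ) (f : V3 → α) : Prop :=
  ∀ (x : V3) (k : Fin 3 → ℤ), f (x + fun i => (N : ℝ) * (k i : ℝ)) = f x

/-- Index set for `Γ_N = {0,…,N−1}³`. -/
abbrev GammaIdx (N : ℕ) : Type := Fin 3 → Fin N

/-- The lattice point of `Γ_N` associated to an index. -/
def embG {N : ℕ} (n : GammaIdx N) : V3 := fun i => ((n i : ℕ) : ℝ)

/-- Fourier coefficient `f̂(ξ) = ∫_{T_N} e^{iξ·x} f(x) dx`. -/
def fCoeff (N : ℕ) (f : V3 → ℂ) (ξ : V3) : ℂ :=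
  ∫ x in cubeN N, Complex.exp (Complex.I * ((dotP ξ x : ℝ) : ℂ)) * f x

/-- Fourier coefficient of a real-valued function. -/
def fCoeffR (N : ℕ) (f : V3 → ℝ) (ξ : V3) : ℂ :=
  fCoeff N (fun x => ((f x : ℝ) : ℂ)) ξ

/-- The point `(2π/N)·k` of the dual lattice `Γ*_N`. -/
def xiN (N : ℕ) (k : Fin 3 → ℤ) : V3 := fun i => (2 * π / (N : ℝ)) * (k i : ℝ)

/-- The Jellium condition: `σ̂(ξ) = 0` for all `ξ ∈ Γ*_1 \ {0}`. -/
def JelliumCond (N : ℕ) (σ : V3 → ℝ) : Prop :=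
  ∀ k : Fin 3 → ℤ, k ≠ 0 → fCoeffR N σ (fun i => 2 * π * (k i : ℝ)) = 0

/-- `(2π/N)·k ∈ Γ*_1`, i.e. every coordinate of `k` is divisible by `N`. -/
def inGamma1 (N : ℕ) (k : Fin 3 → ℤ) : Prop := ∀ i, (N : ℤ) ∣ k i

/-- `|∇φ(x)|²` for a complex-valued function. -/
def gradSq (φ : V3 → ℂ) (x : V3) : ℝ :=
  ∑ i, Complex.normSq (fderiv ℝ φ x (Pi.single i 1))

/-- Gradient of a real-valued function on `ℝ³`. -/
def gradV (f : V3 → ℝ) (x : V3) : V3 := fun i => fderiv ℝ f x (Pi.single i 1)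

/-- Total charge density `ρ(x) = ∑_n σ(x−n−q(n)) − e|ψ(x)|²`. -/
def rhoT (N : ℕ) (σ : V3 → ℝ) (e : ℝ) (ψ : V3 → ℂ) (q : GammaIdx N → V3) (x : V3) : ℝ :=
  (∑ n : GammaIdx N, σ (x - embG n - q n)) - e * Complex.normSq (ψ x)

/-- `∑_{ξ∈Γ*_N\{0}} |f̂(ξ)|²/|ξ|²`. -/
def dualSum (N : ℕ) (f : V3 → ℝ) : ℝ :=
  ∑' k : Fin 3 → ℤ, if k = 0 then 0 else
    Complex.normSq (fCoeffR N f (xiN N k)) / nsqV (xiN N k)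

/-- The energy functional `E(ψ,q,p)`. -/
def energyE (N : ℕ) (σ : V3 → ℝ) (e M : ℝ) (ψ : V3 → ℂ) (q p : GammaIdx N → V3) : ℝ :=
  (1 / 2) * (∫ x in cubeN N, gradSq ψ x)
    + (2 * (N : ℝ) ^ 3)⁻¹ * dualSum N (rhoT N σ e ψ q)
    + (2 * M)⁻¹ * ∑ n : GammaIdx N, nsqV (p n)

/-- The matrix `Σ(θ) = ∑_{m∈ℤ³} (ξξᵀ/|ξ|²)|σ̂(ξ)|²`, `ξ = θ + 2πm`. -/
def SigMat (N : ℕ) (σ : V3 → ℝ) (θ : V3) : Matrix (Fin 3) (Fin 3) ℝ :=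
  Matrix.of fun a b => ∑' m : Fin 3 → ℤ,
    ((θ a + 2 * π * (m a : ℝ)) * (θ b + 2 * π * (m b : ℝ))
        / nsqV (fun i => θ i + 2 * π * (m i : ℝ)))
      * Complex.normSq (fCoeffR N σ (fun i => θ i + 2 * π * (m i : ℝ)))

/-- The Wiener condition: `Σ(θ)` is positive definite for all `θ ∈ Γ*_N \ Γ*_1`. -/
def WienerCond (N : ℕ) (σ : V3 → ℝ) : Prop :=
  ∀ k : Fin 3 → ℤ, ¬ inGamma1 N k → (SigMat N σ (xiN N k)).PosDef

/-- First-order ionic density `σ⁽¹⁾(x) = −∑_n κ(n)·∇σ(x−n−r)`. -/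
def sigma1F (N : ℕ) (σ : V3 → ℝ) (r : V3) (κ : GammaIdx N → V3) (x : V3) : ℝ :=
  - ∑ n : GammaIdx N, dotP (κ n) (gradV σ (x - embG n - r))

/-- First-order charge density `ρ⁽¹⁾(x) = σ⁽¹⁾(x) − 2e√Z·Re(e^{−iα}φ(x))`. -/
def rho1F (N : ℕ) (σ : V3 → ℝ) (e Z α : ℝ) (r : V3) (κ : GammaIdx N → V3)
    (φ : V3 → ℂ) (x : V3) : ℝ :=
  sigma1F N σ r κ x - 2 * e * Real.sqrt Z * (Complex.exp (-Complex.I * (α : ℂ)) * φ x).re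

/-- The quadratic form `B(φ,κ,p)` (half of the energy Hessian). -/
def BformQ (N : ℕ) (σ : V3 → ℝ) (e Z M α : ℝ) (r : V3)
    (φ : V3 → ℂ) (κ p : GammaIdx N → V3) : ℝ :=
  (1 / 2) * (∫ x in cubeN N, gradSq φ x)
    + (2 * (N : ℝ) ^ 3)⁻¹ * dualSum N (rho1F N σ e Z α r κ φ)
    + (2 * M)⁻¹ * ∑ n : GammaIdx N, nsqV (p n)

/-- Second-order charge density `ρ⁽²⁾`. -/
def rho2F (N : ℕ) (σ : V3 → ℝ) (e : ℝ) (r : V3) (κ : GammaIdx N → V3)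
    (φ : V3 → ℂ) (x : V3) : ℝ :=
  (∑ n : GammaIdx N,
      (σ (x - embG n - r - κ n) - σ (x - embG n - r)
        + dotP (κ n) (gradV σ (x - embG n - r))))
    - e * Complex.normSq (φ x)

/-- The pairing `(f, Gg) = N⁻³ ∑_{ξ∈Γ*_N\{0}} Re(f̂(ξ)·conj(ĝ(ξ)))/|ξ|²`. -/
def GPair (N : ℕ) (f g : V3 → ℝ) : ℝ :=
  ((N : ℝ) ^ 3)⁻¹ * ∑' k : Fin 3 → ℤ, if k = 0 then 0 else
    (fCoeffR N f (xiN N k) * (starRingEnd ℂ) (fCoeffR N g (xiN N k))).re / nsqV (xiN N k)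

/-- The distance to the solitary manifold of ground states. -/
def distS (N : ℕ) (Z : ℝ) (ψ : V3 → ℂ) (q p : GammaIdx N → V3) : ℝ :=
  ⨅ (α : ℝ) (r : V3),
    (Real.sqrt (∫ x in cubeN N,
        (Complex.normSq (ψ x - Complex.exp (Complex.I * (α : ℂ)) * ((Real.sqrt Z : ℝ) : ℂ))
          + gradSq ψ x))
      + Real.sqrt (∑ n : GammaIdx N, ⨅ k : Fin 3 → ℤ,
          nsqV (fun i => q n i - r i - (N : ℝ) * (k i : ℝ)))
      + Real.sqrt (∑ n : GammaIdx N, nsqV (p n)))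

/-- The discrete Fourier transform `κ̂(θ) ∈ ℂ³` of `κ : Γ_N → ℝ³`. -/
def hatK (N : ℕ) (κ : GammaIdx N → V3) (θ : V3) (a : Fin 3) : ℂ :=
  ∑ n : GammaIdx N, Complex.exp (Complex.I * ((dotP θ (embG n) : ℝ) : ℂ)) * ((κ n a : ℝ) : ℂ)

/-- Laplacian of a complex-valued function on `ℝ³`. -/
def lapC (f : V3 → ℂ) (x : V3) : ℂ :=
  ∑ i, fderiv ℝ (fun y => fderiv ℝ f y (Pi.single i 1)) x (Pi.single i 1)

/-- Laplacian of a real-valued function on `ℝ³`. -/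
def lapR (f : V3 → ℝ) (x : V3) : ℝ :=
  ∑ i, fderiv ℝ (fun y => fderiv ℝ f y (Pi.single i 1)) x (Pi.single i 1)

/-- A classical solution of the Schrödinger–Poisson–Newton system on `ℝ`. -/
structure IsSPN (N : ℕ) (σ : V3 → ℝ) (e M : ℝ)
    (ψ : V3 → ℝ → ℂ) (Φ : V3 → ℝ → ℝ) (q : ℝ → GammaIdx N → V3) : Prop where
  per_psi : ∀ t : ℝ, IsPerN N (fun x => ψ x t)
  per_Phi : ∀ t : ℝ, IsPerN N (fun x => Φ x t)
  regx_psi : ∀ t : ℝ, ContDiff ℝ 2 (fun x => ψ x t)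
  regt_psi : ∀ x : V3, ContDiff ℝ 1 (fun t => ψ x t)
  regx_Phi : ∀ t : ℝ, ContDiff ℝ 2 (fun x => Φ x t)
  regt_Phi : ∀ x : V3, ContDiff ℝ 1 (fun t => Φ x t)
  reg_q : ContDiff ℝ 2 q
  schrodinger : ∀ (x : V3) (t : ℝ),
    Complex.I * deriv (fun s => ψ x s) t =
      -(1 / 2 : ℂ) * lapC (fun y => ψ y t) x - ((e : ℝ) : ℂ) * ((Φ x t : ℝ) : ℂ) * ψ x t
  poisson : ∀ (x : V3) (t : ℝ),
    - lapR (fun y => Φ y t) x =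
      (∑ n : GammaIdx N, σ (x - embG n - q t n)) - e * Complex.normSq (ψ x t)
  newton : ∀ (n : GammaIdx N) (t : ℝ) (i : Fin 3),
    M * deriv (fun s => deriv (fun u => q u n i) s) t =
      - ∫ x in cubeN N, fderiv ℝ (fun y => Φ y t) x (Pi.single i 1) * σ (x - embG n - q t n)


lemma cubeN_eq (N : ℕ) : cubeN N = Set.univ.pi (fun _ : Fin 3 => Set.Ico (0 : ℝ) (N : ℝ)) := by
  ext x; simp [cubeN]

lemma cubeN_meas (N : ℕ) : MeasurableSet (cubeN N) := by
  rw [cubeN_eq]; exact MeasurableSet.univ_pi (fun _ => measurableSet_Ico)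

lemma cubeN_vol (N : ℕ) : volume.real (cubeN N) = (N : ℝ) ^ 3 := by
  rw [cubeN_eq, Measure.real, Real.volume_pi_Ico_toReal (a := fun _ => 0) (b := fun _ => (N:ℝ))]
  · simp
  · intro i; simp

lemma cubeN_sub (N : ℕ) : cubeN N ⊆ Set.Icc (fun _ => (0 : ℝ)) (fun _ => (N : ℝ)) := by
  intro x hx
  exact ⟨fun i => (hx i).1, fun i => (hx i).2.le⟩

lemma cubeN_ae (N : ℕ) : cubeN N =ᵐ[(volume : Measure V3)] Set.Icc (fun _ => (0 : ℝ)) (fun _ => (N : ℝ)) := by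
  rw [cubeN_eq]
  exact Measure.univ_pi_Ico_ae_eq_Icc (f := fun _ => (0:ℝ)) (g := fun _ => (N:ℝ))

lemma cubeN_int {E : Type*} [NormedAddCommGroup E] (N : ℕ) {f : V3 → E}
    (hf : Continuous f) : IntegrableOn f (cubeN N) :=
  (hf.continuousOn.integrableOn_compact isCompact_Icc).mono_set (cubeN_sub N)

instance cubeN_fin (N : ℕ) : IsFiniteMeasure ((volume : Measure V3).restrict (cubeN N)) := by
  constructor
  rw [Measure.restrict_apply_univ]
  exact lt_of_le_of_lt (measure_mono (cubeN_sub N)) isCompact_Icc.measure_lt_top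

def basN (N : ℕ) (hN : 0 < N) : Module.Basis (Fin 3) ℝ V3 :=
  (Pi.basisFun ℝ (Fin 3)).unitsSMul (fun _ => Units.mk0 (N : ℝ) (by positivity))

lemma basN_fd (N : ℕ) (hN : 0 < N) : ZSpan.fundamentalDomain (basN N hN) = cubeN N := by
  have hN' : (0:ℝ) < N := by exact_mod_cast hN
  ext x
  simp only [ZSpan.mem_fundamentalDomain, cubeN, Set.mem_ofPred_eq, basN,
    Module.Basis.repr_unitsSMul, Pi.basisFun_repr, Set.mem_Ico]
  refine forall_congr' fun i => ?_
  simp only [Units.smul_def, Units.val_inv_eq_inv_val, Units.val_mk0, smul_eq_mul]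
  rw [inv_mul_eq_div, div_lt_one hN', le_div_iff₀ hN', zero_mul]

open scoped Pointwise in
lemma trans_inv {E : Type*} [NormedAddCommGroup E] [NormedSpace ℝ E] {N : ℕ} (hN : 0 < N)
    {f : V3 → E} (hf : IsPerN N f) (h : V3) :
    ∫ x in cubeN N, f (x + h) = ∫ x in cubeN N, f x := by
  have h1 := ZSpan.isAddFundamentalDomain (basN N hN) (volume : Measure V3)
  rw [basN_fd] at h1
  have h2 := h1.vadd_of_comm h
  have : VAddInvariantMeasure (Submodule.span ℤ (Set.range (basN N hN))) V3 volume :=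
    ⟨fun c s _ => measure_preimage_add volume (c : V3) s⟩
  have hinv : ∀ (g : Submodule.span ℤ (Set.range (basN N hN))) (x : V3), f (g +ᵥ x) = f x := by
    rintro ⟨g, hg⟩ x
    rw [Module.Basis.mem_span_iff_repr_mem] at hg
    choose k hk using hg
    have : g = fun i => (N : ℝ) * (k i : ℝ) := by
      ext i
      have := hk i
      simp only [basN, Module.Basis.repr_unitsSMul, Pi.basisFun_repr, Units.smul_def,
        Units.val_inv_eq_inv_val, Units.val_mk0, smul_eq_mul] at this
      have hN' : (N:ℝ) ≠ 0 := by positivity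
      simp only [algebraMap_int_eq, eq_intCast] at this
      rw [this]; field_simp
    rw [Submodule.vadd_def, vadd_eq_add, add_comm]
    simp only [this]
    exact hf x k
  rw [h1.setIntegral_eq h2 hinv]
  have : (h +ᵥ cubeN N) = (fun x => x + h) '' cubeN N := by
    rw [← Set.image_vadd]; simp [add_comm]
  rw [this, (measurePreserving_add_right volume h).setIntegral_image_emb
    (MeasurableEquiv.addRight h).measurableEmbedding]

lemma int_deriv {N : ℕ} {g : V3 → ℂ} (hg : IsPerN N g) (hc : ContDiff ℝ 1 g) (i : Fin 3) :
    ∫ x in cubeN N, fderiv ℝ g x (Pi.single i 1) = 0 := by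
  rw [setIntegral_congr_set (cubeN_ae N)]
  have hcd : Continuous (fun x => fderiv ℝ g x (Pi.single i 1)) :=
    (hc.continuous_fderiv (by norm_num)).clm_apply continuous_const
  have key : ∀ x, (∑ j : Fin 3, (if j = i then fderiv ℝ g x else 0) (Pi.single j (1:ℝ)))
      = fderiv ℝ g x (Pi.single i 1) := by
    intro x
    rw [Finset.sum_eq_single i]
    · simp
    · intro j _ hj; simp [hj]
    · simp
  have := integral_divergence_of_hasFDerivAt_off_countable' (n := 2) (E := ℂ)
    (fun _ => (0:ℝ)) (fun _ => (N:ℝ)) (fun _ => by simp)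
    (fun j => if j = i then g else fun _ => 0)
    (fun j x => if j = i then fderiv ℝ g x else 0) ∅ Set.countable_empty
    (fun j => by
      by_cases h : j = i
      · simp only [h, if_true]; exact hc.continuous.continuousOn
      · simp only [h, if_false]; exact continuousOn_const)
    (fun x _ j => by
      by_cases h : j = i
      · simp only [h, if_true]
        exact (hc.differentiable (by norm_num) x).hasFDerivAt
      · simp only [h, if_false]; exact hasFDerivAt_const _ _)
    (by
      simp only [key]
      exact hcd.continuousOn.integrableOn_compact isCompact_Icc)
  simp only [key] at this
  rw [this]
  refine Finset.sum_eq_zero fun j _ => ?_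
  rw [sub_eq_zero]
  congr 1
  ext y
  by_cases h : j = i
  · subst h
    simp only [if_true]
    have h2 := hg (j.insertNth (0:ℝ) y) (Pi.single j 1)
    rw [← h2]
    congr 1
    ext l
    refine Fin.succAboveCases j ?_ (fun m => ?_) l
    · simp
    · simp [Fin.succAbove_ne]
  · simp [h]


/-- the exponential -/
def ex (ξ x : V3) : ℂ := Complex.exp (Complex.I * ((dotP ξ x : ℝ) : ℂ))

lemma dotP_add (ξ x y : V3) : dotP ξ (x + y) = dotP ξ x + dotP ξ y := by
  simp [dotP, mul_add, Finset.sum_add_distrib]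

lemma ex_add (ξ x y : V3) : ex ξ (x + y) = ex ξ x * ex ξ y := by
  rw [ex, ex, ex, dotP_add, ← Complex.exp_add]; push_cast; ring_nf

lemma ex_norm (ξ x : V3) : ‖ex ξ x‖ = 1 := by
  rw [ex, mul_comm]; exact Complex.norm_exp_ofReal_mul_I _

lemma ex_lat {N : ℕ} (hN : 0 < N) (k m : Fin 3 → ℤ) :
    ex (xiN N k) (fun i => (N : ℝ) * (m i : ℝ)) = 1 := by
  have hN' : (N:ℝ) ≠ 0 := by positivity
  have : dotP (xiN N k) (fun i => (N : ℝ) * (m i : ℝ)) = ((∑ i, k i * m i : ℤ) : ℝ) * (2 * π) := by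
    simp only [dotP, xiN]
    push_cast
    rw [Finset.sum_mul]
    refine Finset.sum_congr rfl fun i _ => ?_
    field_simp
  rw [ex, this, Complex.exp_eq_one_iff]
  exact ⟨∑ i, k i * m i, by push_cast; ring⟩

lemma ex_per {N : ℕ} (hN : 0 < N) (k : Fin 3 → ℤ) : IsPerN N (ex (xiN N k)) := by
  intro x m
  rw [ex_add, ex_lat hN, mul_one]

lemma ex_hasFDeriv (ξ x : V3) : HasFDerivAt (ex ξ)
    (ex ξ x • (Complex.I • (Complex.ofRealCLM.comp (∑ i, ξ i • ContinuousLinearMap.proj (R := ℝ) (φ := fun _ : Fin 3 => ℝ) i)))) x := by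
  have h1 : HasFDerivAt (fun y : V3 => dotP ξ y)
      (∑ i, ξ i • ContinuousLinearMap.proj (R := ℝ) (φ := fun _ : Fin 3 => ℝ) i) x := by
    unfold dotP
    refine HasFDerivAt.fun_sum fun i _ => ?_
    exact (hasFDerivAt_apply i x).const_mul (ξ i)
  have h2 := Complex.ofRealCLM.hasFDerivAt.comp x h1
  have h3 := h2.const_mul Complex.I
  exact h3.cexp

lemma ex_fderiv (ξ x : V3) (i : Fin 3) :
    fderiv ℝ (ex ξ) x (Pi.single i 1) = Complex.I * (ξ i : ℂ) * ex ξ x := by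
  rw [(ex_hasFDeriv ξ x).fderiv]
  simp [Pi.single_apply]
  ring

lemma ex_contDiff (ξ : V3) : ContDiff ℝ 1 (ex ξ) := by
  have h : ContDiff ℝ 1 (fun x : V3 => ∑ i : Fin 3, ξ i * x i) :=
    ContDiff.sum fun i _ => contDiff_const.mul (contDiff_apply ℝ ℝ i)
  exact (contDiff_const.mul (Complex.ofRealCLM.contDiff.comp h)).cexp

lemma ex_cont (ξ : V3) : Continuous (ex ξ) := (ex_contDiff ξ).continuous

lemma fCoeff_eq (N : ℕ) (f : V3 → ℂ) (ξ : V3) :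
    fCoeff N f ξ = ∫ x in cubeN N, ex ξ x * f x := rfl

lemma per_mul {N : ℕ} {f g : V3 → ℂ} (hf : IsPerN N f) (hg : IsPerN N g) :
    IsPerN N (fun x => f x * g x) := by
  intro x k; simp only [hf x k, hg x k]

lemma per_shift {α : Type*} {N : ℕ} {f : V3 → α} (hf : IsPerN N f) (h : V3) :
    IsPerN N (fun x => f (x - h)) := by
  intro x k
  simp only
  rw [← hf (x - h) k]; congr 1; abel

lemma fCoeff_deriv {N : ℕ} (hN : 0 < N) {f : V3 → ℂ} (hf : IsPerN N f) (hc : ContDiff ℝ 1 f)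
    (k : Fin 3 → ℤ) (i : Fin 3) :
    fCoeff N (fun x => fderiv ℝ f x (Pi.single i 1)) (xiN N k)
      = -(Complex.I * (xiN N k i : ℂ) * fCoeff N f (xiN N k)) := by
  have h0 := int_deriv (per_mul (ex_per hN k) hf) ((ex_contDiff (xiN N k)).mul hc) i
  have hd : ∀ x, fderiv ℝ (fun x => ex (xiN N k) x * f x) x (Pi.single i 1)
      = ex (xiN N k) x * fderiv ℝ f x (Pi.single i 1)
        + Complex.I * (xiN N k i : ℂ) * (ex (xiN N k) x * f x) := by
    intro x
    rw [fderiv_fun_mul ((ex_contDiff (xiN N k)).differentiable (by norm_num) x)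
      (hc.differentiable (by norm_num) x)]
    simp only [add_apply, smul_apply, ex_fderiv, smul_eq_mul]
    ring
  simp only [hd] at h0
  have hcd : Continuous (fun x => fderiv ℝ f x (Pi.single i 1)) :=
    (hc.continuous_fderiv (by norm_num)).clm_apply continuous_const
  have c1 : Continuous (fun x => ex (xiN N k) x * fderiv ℝ f x (Pi.single i 1)) :=
    (ex_cont _).mul hcd
  have c2 : Continuous (fun x => Complex.I * (xiN N k i : ℂ) * (ex (xiN N k) x * f x)) :=
    continuous_const.mul ((ex_cont _).mul hc.continuous)
  rw [integral_add (cubeN_int N c1) (cubeN_int N c2), integral_const_mul] at h0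
  rw [fCoeff_eq, fCoeff_eq]
  linear_combination h0

lemma fCoeff_shift {N : ℕ} (hN : 0 < N) {f : V3 → ℂ} (hf : IsPerN N f) 
    (k : Fin 3 → ℤ) (h : V3) :
    fCoeff N (fun x => f (x - h)) (xiN N k) = ex (xiN N k) h * fCoeff N f (xiN N k) := by
  have := trans_inv hN (per_mul (ex_per hN k) (per_shift hf h)) h
  rw [fCoeff_eq, ← this, fCoeff_eq, ← integral_const_mul]
  congr 1
  ext x
  rw [ex_add, add_sub_cancel_right]; ring

lemma fCoeff_sum {ι : Type*} (N : ℕ) (s : Finset ι) (c : ι → ℂ) (f : ι → V3 → ℂ)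
    (hf : ∀ i, Continuous (f i)) (ξ : V3) :
    fCoeff N (fun x => ∑ i ∈ s, c i * f i x) ξ = ∑ i ∈ s, c i * fCoeff N (f i) ξ := by
  simp only [fCoeff_eq, ← integral_const_mul]
  rw [← integral_finsetSum]
  · congr 1; ext x; rw [Finset.mul_sum]; exact Finset.sum_congr rfl fun i _ => by ring
  · intro i _; exact cubeN_int N (continuous_const.mul ((ex_cont _).mul (hf i)))

lemma fCoeff_sigma1 {N : ℕ} (hN : 0 < N) {σ : V3 → ℝ} (hper : IsPerN N σ) (hreg : ContDiff ℝ 2 σ)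
    (r : V3) (κ : GammaIdx N → V3) (k : Fin 3 → ℤ) :
    fCoeffR N (sigma1F N σ r κ) (xiN N k) =
      Complex.I * ex (xiN N k) r * fCoeffR N σ (xiN N k) *
        ∑ a, (xiN N k a : ℂ) * hatK N κ (xiN N k) a := by
  set ξ := xiN N k with hξ
  set S : V3 → ℂ := fun x => ((σ x : ℝ) : ℂ) with hS
  have hSper : IsPerN N S := fun x k => by simp only [hS, hper x k]
  have hSreg : ContDiff ℝ 1 S := Complex.ofRealCLM.contDiff.comp (hreg.of_le (by norm_num))
  have hSd : ∀ x i, fderiv ℝ S x (Pi.single i 1) = ((gradV σ x i : ℝ) : ℂ) := by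
    intro x i
    have := (Complex.ofRealCLM.hasFDerivAt.comp x
      ((hreg.differentiable (by norm_num) x).hasFDerivAt))
    have h2 : fderiv ℝ S x = _ := this.fderiv
    rw [h2]; rfl
  have hper' : ∀ i, IsPerN N (fun x => fderiv ℝ S x (Pi.single i 1)) := by
    intro i x m
    have h1 := fderiv_comp_add_right (𝕜 := ℝ) (f := S) (x := x) (fun i => (N:ℝ) * (m i : ℝ))
    have h2 : (fun x => S (x + fun i => (N:ℝ) * (m i : ℝ))) = S := funext fun x => hSper x m
    rw [h2] at h1
    simp only [h1]
  have e1 : (fun x => ((sigma1F N σ r κ x : ℝ) : ℂ)) = fun x =>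
      ∑ q : GammaIdx N × Fin 3, (-(κ q.1 q.2 : ℂ)) *
        (fun y => fderiv ℝ S (y - (embG q.1 + r)) (Pi.single q.2 1)) x := by
    ext x
    simp only [hSd, sigma1F, dotP, Fintype.sum_prod_type]
    push_cast
    simp only [neg_mul, Finset.sum_neg_distrib, sub_sub]
  have hcd : ∀ i, Continuous (fun x => fderiv ℝ S x (Pi.single i 1)) := fun i =>
    (hSreg.continuous_fderiv (by norm_num)).clm_apply continuous_const
  rw [fCoeffR, e1, fCoeff_sum N Finset.univ]
  · have : ∀ q : GammaIdx N × Fin 3, fCoeff N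
        (fun y => fderiv ℝ S (y - (embG q.1 + r)) (Pi.single q.2 1)) ξ
        = - (ex ξ (embG q.1) * ex ξ r * (Complex.I * (ξ q.2 : ℂ) * fCoeffR N σ ξ)) := by
      intro q
      rw [hξ, fCoeff_shift hN (hper' q.2) k, fCoeff_deriv hN hSper hSreg, ex_add]
      rw [fCoeffR]; ring
    simp only [this, Fintype.sum_prod_type, hatK]
    rw [Finset.sum_comm, Finset.mul_sum]
    refine Finset.sum_congr rfl fun a _ => ?_
    rw [Finset.mul_sum, Finset.mul_sum]
    refine Finset.sum_congr rfl fun n _ => ?_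
    rw [show Complex.exp (Complex.I * ((dotP ξ (embG n) : ℝ) : ℂ)) = ex ξ (embG n) from rfl]
    ring
  · intro q
    exact (hcd q.2).comp (continuous_id.sub continuous_const)


lemma int_ex {N : ℕ} (hN : 0 < N) (k : Fin 3 → ℤ) (hk : k ≠ 0) :
    ∫ x in cubeN N, ex (xiN N k) x = 0 := by
  obtain ⟨i, hi⟩ : ∃ i, k i ≠ 0 := by
    by_contra! h; exact hk (funext h)
  have h := int_deriv (ex_per hN k) (ex_contDiff _) i
  simp only [ex_fderiv] at h
  rw [integral_const_mul] at h
  rcases mul_eq_zero.1 h with h | h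
  · exfalso
    have hN' : (N:ℝ) ≠ 0 := by positivity
    have : xiN N k i ≠ 0 := by
      simp only [xiN]
      have : (k i : ℝ) ≠ 0 := by exact_mod_cast hi
      positivity
    simp [this] at h
  · exact h

lemma ex_conj_mul (N : ℕ) (k l : Fin 3 → ℤ) (x : V3) :
    ex (xiN N k) x * (starRingEnd ℂ) (ex (xiN N l) x) = ex (xiN N (k - l)) x := by
  simp only [ex, ← Complex.exp_conj, ← Complex.exp_add]
  congr 1
  simp only [map_mul, Complex.conj_I, Complex.conj_ofReal]
  have : dotP (xiN N (k - l)) x = dotP (xiN N k) x - dotP (xiN N l) x := by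
    simp only [dotP, xiN, ← Finset.sum_sub_distrib]
    refine Finset.sum_congr rfl fun i _ => ?_
    simp; ring
  rw [this]; push_cast; ring

lemma memLp_cube (N : ℕ) {f : V3 → ℂ} (hf : Continuous f) :
    MemLp f 2 ((volume : Measure V3).restrict (cubeN N)) := by
  rw [memLp_two_iff_integrable_sq_norm hf.aestronglyMeasurable]
  exact cubeN_int N (hf.norm.pow 2)

lemma bessel_aux {N : ℕ} (hN : 0 < N) {f : V3 → ℂ} (hf : Continuous f) :
    Summable (fun k => Complex.normSq (fCoeff N f (xiN N k))) ∧
    ∑' k, Complex.normSq (fCoeff N f (xiN N k)) ≤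
      (N:ℝ)^3 * ∫ x in cubeN N, Complex.normSq (f x) := by
  have hN3 : (0:ℝ) < (N:ℝ)^3 := by positivity
  set μ := (volume : Measure V3).restrict (cubeN N) with hμ
  set c : ℝ := (Real.sqrt ((N:ℝ)^3))⁻¹ with hc
  have hcc : c * c = ((N:ℝ)^3)⁻¹ := by
    rw [hc, ← mul_inv, Real.mul_self_sqrt hN3.le]
  have hcont : ∀ k, Continuous (fun x => (c:ℂ) * (starRingEnd ℂ) (ex (xiN N k) x)) := fun k =>
    continuous_const.mul (Complex.continuous_conj.comp (ex_cont _))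
  let v : (Fin 3 → ℤ) → Lp ℂ 2 μ := fun k => (memLp_cube N (hcont k)).toLp _
  have hinner : ∀ (g h : V3 → ℂ) (hg : MemLp g 2 μ) (hh : MemLp h 2 μ),
      inner ℂ (hg.toLp g) (hh.toLp h) = ∫ x, h x * (starRingEnd ℂ) (g x) ∂μ := by
    intro g h hg hh
    rw [L2.inner_def]
    refine integral_congr_ae ?_
    filter_upwards [hg.coeFn_toLp, hh.coeFn_toLp] with x h1 h2
    rw [h1, h2]; rfl
  have hv : Orthonormal ℂ v := by
    rw [orthonormal_iff_ite]
    intro k l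
    rw [hinner]
    have : ∀ x, (c:ℂ) * (starRingEnd ℂ) (ex (xiN N l) x) *
        (starRingEnd ℂ) ((c:ℂ) * (starRingEnd ℂ) (ex (xiN N k) x))
        = ((c * c : ℝ) : ℂ) * ex (xiN N (k - l)) x := by
      intro x
      rw [← ex_conj_mul]
      simp only [map_mul, Complex.conj_conj, Complex.conj_ofReal]
      push_cast; ring
    simp only [this]
    rw [integral_const_mul]
    split_ifs with h
    · subst h
      have h1 : ∀ x, ex (xiN N (k - k)) x = 1 := by
        intro x; simp [ex, dotP, xiN]
      simp only [h1, integral_const]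
      rw [hμ, measureReal_restrict_apply_univ, cubeN_vol, hcc]
      rw [Complex.real_smul, mul_one, ← Complex.ofReal_mul, inv_mul_cancel₀ hN3.ne']; simp
    · rw [hμ, int_ex hN _ (sub_ne_zero.2 h), mul_zero]
  let F := (memLp_cube N hf).toLp f
  have hF : ∀ k, ‖inner ℂ (v k) F‖ ^ 2 = ((N:ℝ)^3)⁻¹ * Complex.normSq (fCoeff N f (xiN N k)) := by
    intro k
    rw [hinner]
    have : ∀ x, f x * (starRingEnd ℂ) ((c:ℂ) * (starRingEnd ℂ) (ex (xiN N k) x))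
        = (c : ℂ) * (ex (xiN N k) x * f x) := by
      intro x
      simp only [map_mul, Complex.conj_conj, Complex.conj_ofReal]; ring
    simp only [this]
    rw [integral_const_mul, norm_mul, mul_pow, Complex.norm_real, Real.norm_eq_abs, sq_abs,
      ← Complex.normSq_eq_norm_sq, sq, hcc]
    rfl
  have hFn : ‖F‖ ^ 2 = ∫ x in cubeN N, Complex.normSq (f x) := by
    have h1 : ((‖F‖^2 : ℝ) : ℂ) = inner ℂ F F := by
      rw [inner_self_eq_norm_sq_to_K]; simp
    rw [hinner] at h1
    simp only [Complex.mul_conj] at h1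
    rw [integral_complex_ofReal] at h1
    exact_mod_cast h1
  have hs := hv.inner_products_summable (x := F)
  have ht := hv.tsum_inner_products_le (x := F)
  simp only [hF] at hs ht
  have hne : ((N:ℝ)^3)⁻¹ ≠ 0 := by positivity
  refine ⟨(summable_mul_left_iff hne).1 hs, ?_⟩
  rw [tsum_mul_left, hFn, inv_mul_le_iff₀ hN3] at ht
  exact ht

lemma gradSq_cont {φ : V3 → ℂ} (hc : ContDiff ℝ 1 φ) : Continuous (gradSq φ) := by
  unfold gradSq
  exact continuous_finsetSum _ fun i _ => Complex.continuous_normSq.comp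
    ((hc.continuous_fderiv (by norm_num)).clm_apply continuous_const)

lemma gradSq_per {N : ℕ} {φ : V3 → ℂ} (hφ : IsPerN N φ) : IsPerN N (gradSq φ) := by
  intro x m
  have h1 := fderiv_comp_add_right (𝕜 := ℝ) (f := φ) (x := x) (fun i => (N:ℝ) * (m i : ℝ))
  have h2 : (fun x => φ (x + fun i => (N:ℝ) * (m i : ℝ))) = φ := funext fun x => hφ x m
  rw [h2] at h1
  simp only [gradSq, h1]

lemma nsq_cs {φ : V3 → ℂ} (y h : V3) :
    Complex.normSq (fderiv ℝ φ y h) ≤ nsqV h * gradSq φ y := by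
  have h1 : fderiv ℝ φ y h = ∑ i, (h i : ℂ) * fderiv ℝ φ y (Pi.single i 1) := by
    conv_lhs => rw [pi_eq_sum_univ' h]
    rw [map_sum]
    refine Finset.sum_congr rfl fun i _ => ?_
    rw [map_smul, Complex.real_smul]
  rw [h1, Complex.normSq_eq_norm_sq]
  have h2 : ‖∑ i, (h i : ℂ) * fderiv ℝ φ y (Pi.single i 1)‖
      ≤ ∑ i, |h i| * ‖fderiv ℝ φ y (Pi.single i 1)‖ := by
    refine (norm_sum_le _ _).trans (le_of_eq ?_)
    refine Finset.sum_congr rfl fun i _ => ?_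
    rw [norm_mul, Complex.norm_real, Real.norm_eq_abs]
  calc _ ≤ (∑ i, |h i| * ‖fderiv ℝ φ y (Pi.single i 1)‖)^2 := by gcongr
    _ ≤ (∑ i, |h i|^2) * ∑ i, ‖fderiv ℝ φ y (Pi.single i 1)‖^2 := Finset.sum_mul_sq_le_sq_mul_sq _ _ _
    _ = _ := by simp only [sq_abs, nsqV, gradSq, Complex.normSq_eq_norm_sq]


lemma prod_int {m n : ℕ} {A K : Set (Fin m → ℝ)} {B L : Set (Fin n → ℝ)} (hA : A ⊆ K) (hB : B ⊆ L)
    (hK : IsCompact K) (hL : IsCompact L) {F : (Fin m → ℝ) × (Fin n → ℝ) → ℝ} (hF : Continuous F) :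
    Integrable F ((volume.restrict A).prod (volume.restrict B)) := by
  rw [Measure.prod_restrict]
  exact (hF.continuousOn.integrableOn_compact (hK.prod hL)).mono_set (Set.prod_mono hA hB)

lemma prod_int' {m : ℕ} {A K : Set (Fin m → ℝ)} {B L : Set ℝ} (hA : A ⊆ K) (hB : B ⊆ L)
    (hK : IsCompact K) (hL : IsCompact L) {F : (Fin m → ℝ) × ℝ → ℝ} (hF : Continuous F) :
    Integrable F ((volume.restrict A).prod (volume.restrict B)) := by
  rw [Measure.prod_restrict]
  exact (hF.continuousOn.integrableOn_compact (hK.prod hL)).mono_set (Set.prod_mono hA hB)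

lemma jensen_sq {g : ℝ → ℝ} (hg : Continuous g) :
    (∫ t in (0:ℝ)..1, g t) ^ 2 ≤ ∫ t in (0:ℝ)..1, g t ^ 2 := by
  set a := ∫ t in (0:ℝ)..1, g t with ha
  have h0 : 0 ≤ ∫ t in (0:ℝ)..1, (g t - a) ^ 2 :=
    intervalIntegral.integral_nonneg zero_le_one fun t _ => sq_nonneg _
  have h1 : ∀ t, (g t - a)^2 = g t ^2 - (2 * a) * g t + a^2 := fun t => by ring
  simp only [h1] at h0
  have i1 : IntervalIntegrable (fun t => g t ^ 2) volume 0 1 := (hg.pow 2).intervalIntegrable _ _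
  have i2 : IntervalIntegrable (fun t => 2 * a * g t) volume 0 1 :=
    (continuous_const.mul hg).intervalIntegrable _ _
  rw [intervalIntegral.integral_add (i1.sub i2) (by simp), intervalIntegral.integral_sub i1 i2,
    intervalIntegral.integral_const_mul, ← ha] at h0
  simp at h0
  nlinarith

lemma pt_diff {φ : V3 → ℂ} (hc : ContDiff ℝ 1 φ) (x h : V3) :
    Complex.normSq (φ (x + h) - φ x) ≤ nsqV h * ∫ t in (0:ℝ)..1, gradSq φ (x + t • h) := by
  have hd : ∀ t : ℝ, HasDerivAt (fun t : ℝ => φ (x + t • h)) (fderiv ℝ φ (x + t • h) h) t := by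
    intro t
    have h1 : HasDerivAt (fun t : ℝ => x + t • h) h t := by
      simpa using ((hasDerivAt_id t).smul_const h).const_add x
    exact (hc.differentiable (by norm_num) _).hasFDerivAt.comp_hasDerivAt t h1
  have hline : Continuous (fun t : ℝ => x + t • h) := by fun_prop
  have hcd : Continuous (fun t : ℝ => fderiv ℝ φ (x + t • h) h) :=
    ((hc.continuous_fderiv (by norm_num)).comp hline).clm_apply continuous_const
  have hftc := intervalIntegral.integral_eq_sub_of_hasDerivAt (a := 0) (b := 1) (fun t _ => hd t)
    (hcd.intervalIntegrable _ _)
  simp only [one_smul, zero_smul, add_zero] at hftc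
  rw [← hftc, Complex.normSq_eq_norm_sq]
  calc _ ≤ (∫ t in (0:ℝ)..1, ‖fderiv ℝ φ (x + t • h) h‖)^2 := by
        gcongr
        exact intervalIntegral.norm_integral_le_integral_norm zero_le_one
    _ ≤ ∫ t in (0:ℝ)..1, ‖fderiv ℝ φ (x + t • h) h‖^2 := jensen_sq hcd.norm
    _ ≤ ∫ t in (0:ℝ)..1, nsqV h * gradSq φ (x + t • h) := by
        refine intervalIntegral.integral_mono_on zero_le_one ((hcd.norm.pow 2).intervalIntegrable _ _)
          ((continuous_const.mul ((gradSq_cont hc).comp hline)).intervalIntegrable _ _) fun t _ => ?_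
        rw [← Complex.normSq_eq_norm_sq]
        exact nsq_cs _ _
    _ = _ := intervalIntegral.integral_const_mul _ _

lemma nsqV_nonneg (h : V3) : 0 ≤ nsqV h := Finset.sum_nonneg fun _ _ => sq_nonneg _

lemma shift_diff {N : ℕ} (hN : 0 < N) {φ : V3 → ℂ} (hφ : IsPerN N φ) (hc : ContDiff ℝ 1 φ) (h : V3) :
    ∫ x in cubeN N, Complex.normSq (φ (x + h) - φ x) ≤ nsqV h * ∫ x in cubeN N, gradSq φ x := by
  have hF : Continuous (fun q : V3 × ℝ => gradSq φ (q.1 + q.2 • h)) :=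
    (gradSq_cont hc).comp (by fun_prop)
  have hint := prod_int' (cubeN_sub N) (Set.Ioc_subset_Icc_self (a := (0:ℝ)) (b := 1))
    isCompact_Icc isCompact_Icc hF
  have c1 : Continuous (fun x => Complex.normSq (φ (x + h) - φ x)) :=
    Complex.continuous_normSq.comp ((hc.continuous.comp (continuous_add_const h)).sub hc.continuous)
  calc _ ≤ ∫ x in cubeN N, nsqV h * ∫ t in Set.Ioc (0:ℝ) 1, gradSq φ (x + t • h) := by
        refine setIntegral_mono (cubeN_int N c1) (hint.integral_prod_left.const_mul _) fun x => ?_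
        have := pt_diff hc x h
        rwa [intervalIntegral.integral_of_le zero_le_one] at this
    _ = nsqV h * ∫ t in Set.Ioc (0:ℝ) 1, ∫ x in cubeN N, gradSq φ (x + t • h) := by
        rw [integral_const_mul, integral_integral_swap hint]
    _ = _ := by
        simp only [trans_inv hN (gradSq_per hφ)]
        simp

lemma poincare {N : ℕ} (hN : 0 < N) {φ : V3 → ℂ} (hφ : IsPerN N φ) (hc : ContDiff ℝ 1 φ)
    (h0 : ∫ x in cubeN N, φ x = 0) :
    ∫ x in cubeN N, Complex.normSq (φ x) ≤ (3 * (N:ℝ)^2) * ∫ x in cubeN N, gradSq φ x := by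
  have hN3 : (0:ℝ) < (N:ℝ)^3 := by positivity
  have hG : 0 ≤ ∫ x in cubeN N, gradSq φ x :=
    integral_nonneg fun x => Finset.sum_nonneg fun _ _ => Complex.normSq_nonneg _
  have hF : Continuous (fun q : V3 × V3 => Complex.normSq (φ (q.1 + q.2) - φ q.1)) :=
    Complex.continuous_normSq.comp ((hc.continuous.comp (by fun_prop)).sub
      (hc.continuous.comp continuous_fst))
  have hint := prod_int (cubeN_sub N) (cubeN_sub N) isCompact_Icc isCompact_Icc hF
  have pt : ∀ x, (N:ℝ)^3 * Complex.normSq (φ x)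
      ≤ ∫ h in cubeN N, Complex.normSq (φ (x + h) - φ x) := by
    intro x
    have csh : Continuous (fun h => φ (x + h)) := hc.continuous.comp (by fun_prop)
    have e : ∀ h, Complex.normSq (φ (x + h) - φ x) = Complex.normSq (φ (x+h)) +
        (Complex.normSq (φ x) - 2 * (φ (x+h) * (starRingEnd ℂ) (φ x)).re) := by
      intro h; rw [Complex.normSq_sub]; ring
    have z : ∫ h in cubeN N, (φ (x+h) * (starRingEnd ℂ) (φ x)).re = 0 := by
      have i0 : Integrable (fun h => φ (x+h) * (starRingEnd ℂ) (φ x)) (volume.restrict (cubeN N)) :=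
        cubeN_int N (csh.mul continuous_const)
      have := integral_re (𝕜 := ℂ) i0
      simp only [RCLike.re_to_complex] at this
      rw [this, integral_mul_const]
      have t := trans_inv hN hφ x
      simp only [add_comm _ x] at t
      rw [t, h0]; simp
    simp only [e]
    have i1 : Integrable (fun h => Complex.normSq (φ (x+h))) (volume.restrict (cubeN N)) :=
      cubeN_int N (Complex.continuous_normSq.comp csh)
    have i2 : Integrable (fun h => 2 * (φ (x+h) * (starRingEnd ℂ) (φ x)).re)
        (volume.restrict (cubeN N)) :=
      cubeN_int N (continuous_const.mul (Complex.continuous_re.comp (csh.mul continuous_const)))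
    have i3 : Integrable (fun h => Complex.normSq (φ x) - 2 * (φ (x+h) * (starRingEnd ℂ) (φ x)).re)
        (volume.restrict (cubeN N)) := (integrable_const _).sub i2
    rw [integral_add i1 i3, integral_sub (integrable_const _) i2,
      integral_const_mul, z, integral_const, measureReal_restrict_apply_univ, cubeN_vol, smul_eq_mul]
    have : 0 ≤ ∫ h in cubeN N, Complex.normSq (φ (x+h)) :=
      integral_nonneg fun _ => Complex.normSq_nonneg _
    linarith
  have main : (N:ℝ)^3 * ∫ x in cubeN N, Complex.normSq (φ x)
      ≤ (N:ℝ)^3 * ((3 * (N:ℝ)^2) * ∫ x in cubeN N, gradSq φ x) := by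
    calc _ = ∫ x in cubeN N, (N:ℝ)^3 * Complex.normSq (φ x) := (integral_const_mul _ _).symm
      _ ≤ ∫ x in cubeN N, ∫ h in cubeN N, Complex.normSq (φ (x + h) - φ x) :=
          setIntegral_mono (cubeN_int N (continuous_const.mul
            (Complex.continuous_normSq.comp hc.continuous))) hint.integral_prod_left pt
      _ = ∫ h in cubeN N, ∫ x in cubeN N, Complex.normSq (φ (x + h) - φ x) :=
          integral_integral_swap hint
      _ ≤ ∫ h in cubeN N, (3 * (N:ℝ)^2) * ∫ x in cubeN N, gradSq φ x := by
          refine setIntegral_mono_on hint.integral_prod_right (integrable_const _) (cubeN_meas N)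
            fun h hh => (shift_diff hN hφ hc h).trans ?_
          refine mul_le_mul_of_nonneg_right ?_ hG
          have : ∀ i, h i ^ 2 ≤ (N:ℝ)^2 := fun i =>
            pow_le_pow_left₀ (hh i).1 (hh i).2.le 2
          rw [nsqV, Fin.sum_univ_three]
          linarith [this 0, this 1, this 2]
      _ = _ := by
          rw [integral_const, measureReal_restrict_apply_univ, cubeN_vol, smul_eq_mul]
  exact le_of_mul_le_mul_left main hN3


lemma posdef_lower {A : Matrix (Fin 3) (Fin 3) ℝ} (hA : A.PosDef) :
    ∃ c > (0:ℝ), ∀ v : V3, c * nsqV v ≤ ∑ a, ∑ b, v a * A a b * v b := by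
  set Q : V3 → ℝ := fun v => ∑ a, ∑ b, v a * A a b * v b with hQ
  have hpos : ∀ v, v ≠ 0 → 0 < Q v := by
    intro v hv
    have := hA.dotProduct_mulVec_pos hv
    have e : Q v = star v ⬝ᵥ A.mulVec v := by
      simp only [hQ, dotProduct, Matrix.mulVec, Finset.mul_sum]
      refine Finset.sum_congr rfl fun a _ => Finset.sum_congr rfl fun b _ => ?_
      change v a * A a b * v b = v a * (A a b * v b)
      ring
    rw [e]; exact this
  have hcont : Continuous Q := by
    refine continuous_finsetSum _ fun a _ => continuous_finsetSum _ fun b _ => ?_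
    fun_prop
  obtain ⟨v0, hv0, hmin⟩ := (isCompact_sphere (0:V3) 1).exists_isMinOn
    (NormedSpace.sphere_nonempty.2 zero_le_one) hcont.continuousOn
  have hv0' : v0 ≠ 0 := by rintro rfl; simp at hv0
  refine ⟨Q v0 / 3, by have := hpos v0 hv0'; positivity, fun v => ?_⟩
  by_cases hv : v = 0
  · subst hv; simp [nsqV]
  have hn : 0 < ‖v‖ := norm_pos_iff.2 hv
  have h1 : Q v0 ≤ Q (‖v‖⁻¹ • v) := by
    apply hmin
    simp [norm_smul, hn.ne']
  have h2 : Q (‖v‖⁻¹ • v) = (‖v‖^2)⁻¹ * Q v := by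
    simp only [hQ, Finset.mul_sum, Pi.smul_apply, smul_eq_mul]
    refine Finset.sum_congr rfl fun a _ => Finset.sum_congr rfl fun b _ => ?_
    field_simp
  rw [h2, le_inv_mul_iff₀ (by positivity)] at h1
  have h3 : nsqV v ≤ 3 * ‖v‖^2 := by
    have : ∀ i, v i ^ 2 ≤ ‖v‖^2 := fun i => by
      rw [← sq_abs]
      exact pow_le_pow_left₀ (abs_nonneg _) (norm_le_pi_norm v i) 2
    rw [nsqV, Fin.sum_univ_three]
    linarith [this 0, this 1, this 2]
  have h4 := hpos v0 hv0'
  change _ ≤ Q v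
  nlinarith

lemma xi_shift {N : ℕ} (hN : 0 < N) (k m : Fin 3 → ℤ) :
    xiN N (k + (N:ℤ) • m) = fun i => xiN N k i + 2 * π * (m i : ℝ) := by
  have hN' : (N:ℝ) ≠ 0 := by positivity
  ext i
  simp only [xiN, Pi.add_apply, Pi.smul_apply, smul_eq_mul]
  push_cast; field_simp

lemma shift_inj {N : ℕ} (hN : 0 < N) (k : Fin 3 → ℤ) :
    Function.Injective (fun m : Fin 3 → ℤ => k + (N:ℤ) • m) := by
  intro m m' h
  have h' := add_left_cancel h
  ext i
  have := congrFun h' i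
  simp only [Pi.smul_apply, smul_eq_mul] at this
  exact mul_left_cancel₀ (by exact_mod_cast hN.ne') this

lemma sig_quad {N : ℕ} (hN : 0 < N) {σ : V3 → ℝ} (hσ : Continuous σ) (k : Fin 3 → ℤ) (v : V3) :
    HasSum (fun m : Fin 3 → ℤ => (dotP (xiN N (k + (N:ℤ) • m)) v)^2 / nsqV (xiN N (k + (N:ℤ) • m))
      * Complex.normSq (fCoeffR N σ (xiN N (k + (N:ℤ) • m))))
      (∑ a, ∑ b, v a * SigMat N σ (xiN N k) a b * v b) := by
  have hb := ((bessel_aux hN (f := fun x => ((σ x : ℝ) : ℂ))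
    (Complex.continuous_ofReal.comp hσ)).1).comp_injective (shift_inj hN k)
  have hs : ∀ a b, HasSum (fun m : Fin 3 → ℤ =>
      (xiN N (k + (N:ℤ) • m) a * xiN N (k + (N:ℤ) • m) b / nsqV (xiN N (k + (N:ℤ) • m)))
      * Complex.normSq (fCoeffR N σ (xiN N (k + (N:ℤ) • m)))) (SigMat N σ (xiN N k) a b) := by
    intro a b
    have e : SigMat N σ (xiN N k) a b = ∑' m : Fin 3 → ℤ,
      (xiN N (k + (N:ℤ) • m) a * xiN N (k + (N:ℤ) • m) b / nsqV (xiN N (k + (N:ℤ) • m)))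
      * Complex.normSq (fCoeffR N σ (xiN N (k + (N:ℤ) • m))) := by
      simp only [xi_shift hN]; rfl
    rw [e]
    apply Summable.hasSum
    refine Summable.of_norm_bounded hb fun m => ?_
    rw [norm_mul, Real.norm_eq_abs, Real.norm_eq_abs, abs_of_nonneg (Complex.normSq_nonneg _)]
    refine mul_le_of_le_one_left (Complex.normSq_nonneg _) ?_
    set ξ := xiN N (k + (N:ℤ) • m)
    have hle : ∀ i, ξ i ^ 2 ≤ nsqV ξ := fun i =>
      Finset.single_le_sum (f := fun i => ξ i ^ 2) (fun _ _ => sq_nonneg _) (Finset.mem_univ i)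
    rw [abs_div, abs_of_nonneg (nsqV_nonneg ξ)]
    refine div_le_one_of_le₀ ?_ (nsqV_nonneg ξ)
    rw [abs_mul]
    nlinarith [hle a, hle b, sq_abs (ξ a), sq_abs (ξ b), sq_nonneg (|ξ a| - |ξ b|)]
  have := hasSum_sum (s := Finset.univ) fun a _ => hasSum_sum (s := Finset.univ) fun b _ =>
    ((hs a b).mul_left (v a)).mul_right (v b)
  refine this.congr_fun ?_ 
  intro m
  set ξ := xiN N (k + (N:ℤ) • m)
  simp only [dotP, Fin.sum_univ_three]
  ring

lemma geom_zero {N : ℕ} (hN : 0 < N) (a b : Fin N) (hab : a ≠ b) :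
    ∑ j : Fin N, Complex.exp (2 * π * Complex.I / N * ((j:ℕ) : ℂ) * (((a:ℕ):ℂ) - ((b:ℕ):ℂ))) = 0 := by
  have hN' : (N:ℂ) ≠ 0 := by exact_mod_cast hN.ne'
  set z := Complex.exp (2 * π * Complex.I / N * (((a:ℕ):ℂ) - ((b:ℕ):ℂ))) with hz
  have h1 : ∀ j : Fin N, Complex.exp (2 * π * Complex.I / N * ((j:ℕ) : ℂ) * (((a:ℕ):ℂ) - ((b:ℕ):ℂ)))
      = z ^ (j:ℕ) := by
    intro j; rw [hz, ← Complex.exp_nat_mul]; congr 1; ring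
  simp only [h1]
  rw [Fin.sum_univ_eq_sum_range (fun j => z ^ j) N]
  have hzN : z ^ N = 1 := by
    rw [hz, ← Complex.exp_nat_mul, Complex.exp_eq_one_iff]
    refine ⟨(a:ℕ) - (b:ℕ), ?_⟩
    push_cast; field_simp
  have hz1 : z ≠ 1 := by
    intro h
    rw [hz, Complex.exp_eq_one_iff] at h
    obtain ⟨n, hn⟩ := h
    have h2 : (((a:ℕ):ℂ) - ((b:ℕ):ℂ)) = n * N := by
      have hp : (2 * π * Complex.I : ℂ) ≠ 0 := Complex.two_pi_I_ne_zero
      field_simp at hn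
      apply mul_left_cancel₀ hp
      linear_combination (2 * π * Complex.I) * hn
    have h3 : ((a:ℕ):ℤ) - ((b:ℕ):ℤ) = n * N := by exact_mod_cast h2
    have ha := a.2
    have hb := b.2
    have : (N:ℤ) ∣ ((a:ℕ):ℤ) - ((b:ℕ):ℤ) := ⟨n, by rw [h3]; ring⟩
    have h4 := Int.eq_zero_of_abs_lt_dvd this (by rw [abs_lt]; constructor <;> omega)
    exact hab (Fin.ext (by omega))
  rw [geom_sum_eq hz1, hzN]; simp

/-- integer frequency of an index -/
def toZ {N : ℕ} (k : GammaIdx N) : Fin 3 → ℤ := fun i => ((k i : ℕ) : ℤ)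

lemma ex_prod {N : ℕ} (k n n' : GammaIdx N) :
    ex (xiN N (toZ k)) (embG n) * (starRingEnd ℂ) (ex (xiN N (toZ k)) (embG n')) =
    ∏ i, Complex.exp (2 * π * Complex.I / N * ((k i:ℕ) : ℂ) * (((n i:ℕ):ℂ) - ((n' i:ℕ):ℂ))) := by
  simp only [ex, ← Complex.exp_conj, ← Complex.exp_add, ← Complex.exp_sum]
  congr 1
  simp only [map_mul, Complex.conj_I, Complex.conj_ofReal, dotP, xiN, toZ, embG]
  push_cast
  rw [neg_mul, ← sub_eq_add_neg, ← mul_sub, ← Finset.sum_sub_distrib, Finset.mul_sum]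
  refine Finset.sum_congr rfl fun i _ => by ring

lemma dft_orth {N : ℕ} (hN : 0 < N) (n n' : GammaIdx N) :
    ∑ k : GammaIdx N, ex (xiN N (toZ k)) (embG n) * (starRingEnd ℂ) (ex (xiN N (toZ k)) (embG n'))
      = if n = n' then (N:ℂ)^3 else 0 := by
  simp only [ex_prod]
  have := Finset.prod_univ_sum (fun _ : Fin 3 => (Finset.univ : Finset (Fin N)))
    (fun i j => Complex.exp (2 * π * Complex.I / N * ((j:ℕ) : ℂ) * (((n i:ℕ):ℂ) - ((n' i:ℕ):ℂ))))
  rw [Fintype.piFinset_univ] at this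
  rw [← this]
  split_ifs with h
  · subst h; simp
  · obtain ⟨i, hi⟩ := Function.ne_iff.1 h
    exact Finset.prod_eq_zero (Finset.mem_univ i) (geom_zero hN _ _ hi)

lemma dft_parseval {N : ℕ} (hN : 0 < N) (κ : GammaIdx N → V3) (a : Fin 3) :
    ∑ k : GammaIdx N, Complex.normSq (hatK N κ (xiN N (toZ k)) a) = (N:ℝ)^3 * ∑ n, κ n a ^ 2 := by
  have h : ((∑ k : GammaIdx N, Complex.normSq (hatK N κ (xiN N (toZ k)) a) : ℝ) : ℂ)
      = (((N:ℝ)^3 * ∑ n, κ n a ^ 2 : ℝ) : ℂ) := by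
    push_cast
    have e : ∀ k : GammaIdx N, ((Complex.normSq (hatK N κ (xiN N (toZ k)) a) : ℝ) : ℂ)
        = ∑ n, ∑ n', (κ n a : ℂ) * (κ n' a : ℂ) * (ex (xiN N (toZ k)) (embG n) *
          (starRingEnd ℂ) (ex (xiN N (toZ k)) (embG n'))) := by
      intro k
      rw [← Complex.mul_conj, hatK, map_sum, Finset.sum_mul_sum]
      refine Finset.sum_congr rfl fun n _ => Finset.sum_congr rfl fun n' _ => ?_
      rw [map_mul, Complex.conj_ofReal]
      simp only [ex]; ring
    simp only [e]
    rw [Finset.sum_comm]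
    rw [Finset.mul_sum]
    refine Finset.sum_congr rfl fun n _ => ?_
    rw [Finset.sum_comm]
    simp only [← Finset.mul_sum, dft_orth hN]
    simp; ring
  exact_mod_cast h


lemma hatK_shift {N : ℕ} (hN : 0 < N) (κ : GammaIdx N → V3) (k m : Fin 3 → ℤ) (a : Fin 3) :
    hatK N κ (xiN N (k + (N:ℤ) • m)) a = hatK N κ (xiN N k) a := by
  unfold hatK
  refine Finset.sum_congr rfl fun n _ => ?_
  congr 1
  rw [Complex.exp_eq_exp_iff_exists_int]
  refine ⟨∑ i, m i * ((n i : ℕ) : ℤ), ?_⟩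
  rw [xi_shift hN]
  simp only [dotP, embG, add_mul, Finset.sum_add_distrib]
  push_cast
  simp only [Fin.sum_univ_three]
  ring

lemma T_low {N : ℕ} (hN : 0 < N) {σ : V3 → ℝ} (hσ : Continuous σ) (hW : WienerCond N σ) :
    ∃ c > (0:ℝ), ∀ (κ : GammaIdx N → V3), (∑ n, κ n) = 0 → ∀ t : (Fin 3 → ℤ) → ℝ,
      (∀ k, t k = Complex.normSq (fCoeffR N σ (xiN N k)) *
        Complex.normSq (∑ a, (xiN N k a : ℂ) * hatK N κ (xiN N k) a) / nsqV (xiN N k)) →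
      Summable t → c * ∑ n, nsqV (κ n) ≤ ∑' k, t k := by
  have h1 : ∀ k : GammaIdx N, ∃ c > (0:ℝ), ¬ inGamma1 N (toZ k) → ∀ v : V3,
      c * nsqV v ≤ ∑ a, ∑ b, v a * SigMat N σ (xiN N (toZ k)) a b * v b := by
    intro k
    by_cases h : inGamma1 N (toZ k)
    · exact ⟨1, one_pos, fun h' => absurd h h'⟩
    · obtain ⟨c, hc, hv⟩ := posdef_lower (hW _ h)
      exact ⟨c, hc, fun _ => hv⟩
  choose cf hcf hcv using h1
  have hne : (Finset.univ : Finset (GammaIdx N)).Nonempty := ⟨fun _ => ⟨0, hN⟩, Finset.mem_univ _⟩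
  obtain ⟨k0, -, hk0⟩ := Finset.exists_min_image Finset.univ cf hne
  have hN3 : (0:ℝ) < (N:ℝ)^3 := by positivity
  refine ⟨cf k0 * (N:ℝ)^3, mul_pos (hcf k0) hN3, fun κ hκ t ht hs => ?_⟩
  have htn : ∀ k, 0 ≤ t k := fun k => by
    rw [ht]; exact div_nonneg (mul_nonneg (Complex.normSq_nonneg _) (Complex.normSq_nonneg _))
      (nsqV_nonneg _)
  let j : GammaIdx N × (Fin 3 → ℤ) → (Fin 3 → ℤ) := fun q => toZ q.1 + (N:ℤ) • q.2
  have hj : Function.Injective j := by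
    rintro ⟨k, m⟩ ⟨k', m'⟩ h
    have hi : ∀ i, ((k i : ℕ):ℤ) + N * m i = ((k' i : ℕ):ℤ) + N * m' i := fun i => by
      have := congrFun h i
      simpa [j, toZ] using this
    have hk : k = k' := by
      ext i
      have h2 := hi i
      have ha := (k i).2
      have hb := (k' i).2
      have hd : (N:ℤ) ∣ ((k i : ℕ):ℤ) - ((k' i : ℕ):ℤ) := ⟨m' i - m i, by linarith⟩
      have h4 := Int.eq_zero_of_abs_lt_dvd hd (by rw [abs_lt]; constructor <;> omega)
      omega
    subst hk
    have hm : m = m' := shift_inj hN (toZ k) h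
    rw [hm]
  have hs' := hs.comp_injective hj
  have hle := tsum_comp_le_tsum_of_inj hs htn hj
  refine le_trans ?_ hle
  rw [hs'.tsum_prod, tsum_fintype]
  have hk : ∀ k : GammaIdx N, cf k0 * ∑ a, Complex.normSq (hatK N κ (xiN N (toZ k)) a)
      ≤ ∑' m, (t ∘ j) (k, m) := by
    intro k
    by_cases h : inGamma1 N (toZ k)
    · have hz : toZ k = 0 := by
        ext i
        have ha := (k i).2
        refine Int.eq_zero_of_abs_lt_dvd (h i) ?_
        simp only [toZ]; rw [abs_lt]; constructor <;> omega
      have hh : ∀ a, hatK N κ (xiN N (toZ k)) a = 0 := by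
        intro a
        have := congrFun hκ a
        simp only [Finset.sum_apply, Pi.zero_apply] at this
        simp only [hatK, hz, xiN, dotP]
        simp
        exact_mod_cast this
      simp only [hh]
      simp only [map_zero, Finset.sum_const_zero, mul_zero]
      exact tsum_nonneg fun m => htn _
    · set u : V3 := fun a => (hatK N κ (xiN N (toZ k)) a).re with hu
      set w : V3 := fun a => (hatK N κ (xiN N (toZ k)) a).im with hw
      have hq := (sig_quad hN hσ (toZ k) u).add (sig_quad hN hσ (toZ k) w)
      have e : ∀ m, (t ∘ j) (k, m) = (dotP (xiN N (toZ k + (N:ℤ) • m)) u)^2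
            / nsqV (xiN N (toZ k + (N:ℤ) • m))
            * Complex.normSq (fCoeffR N σ (xiN N (toZ k + (N:ℤ) • m)))
          + (dotP (xiN N (toZ k + (N:ℤ) • m)) w)^2 / nsqV (xiN N (toZ k + (N:ℤ) • m))
            * Complex.normSq (fCoeffR N σ (xiN N (toZ k + (N:ℤ) • m))) := by
        intro m
        simp only [Function.comp_apply, j, ht, hatK_shift hN]
        have : Complex.normSq (∑ a, (xiN N (toZ k + (N:ℤ) • m) a : ℂ) * hatK N κ (xiN N (toZ k)) a)
            = (dotP (xiN N (toZ k + (N:ℤ) • m)) u)^2 + (dotP (xiN N (toZ k + (N:ℤ) • m)) w)^2 := by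
          rw [Complex.normSq_apply]
          simp only [Complex.re_sum, Complex.im_sum, Complex.re_ofReal_mul, Complex.im_ofReal_mul,
            dotP, hu, hw]
          ring
        rw [this]; ring
      simp only [e]
      rw [hq.tsum_eq]
      have b1 := hcv k h u
      have b2 := hcv k h w
      have b3 := hk0 k (Finset.mem_univ k)
      have e2 : ∑ a, Complex.normSq (hatK N κ (xiN N (toZ k)) a) = nsqV u + nsqV w := by
        simp only [nsqV, hu, hw, ← Finset.sum_add_distrib]
        refine Finset.sum_congr rfl fun a _ => ?_
        rw [Complex.normSq_apply]; ring
      rw [e2]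
      nlinarith [nsqV_nonneg u, nsqV_nonneg w, mul_le_mul_of_nonneg_right b3 (nsqV_nonneg u),
        mul_le_mul_of_nonneg_right b3 (nsqV_nonneg w)]
  calc cf k0 * (N:ℝ)^3 * ∑ n, nsqV (κ n)
      = ∑ k : GammaIdx N, cf k0 * ∑ a, Complex.normSq (hatK N κ (xiN N (toZ k)) a) := by
        rw [← Finset.mul_sum, Finset.sum_comm]
        simp only [dft_parseval hN, nsqV]
        rw [← Finset.mul_sum, Finset.sum_comm, mul_assoc]
    _ ≤ _ := Finset.sum_le_sum fun k _ => hk k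

lemma nsq_xi_lower {N : ℕ} (hN : 0 < N) (k : Fin 3 → ℤ) (hk : k ≠ 0) :
    1 ≤ (N:ℝ)^2 * nsqV (xiN N k) := by
  obtain ⟨i, hi⟩ : ∃ i, k i ≠ 0 := by
    by_contra! h; exact hk (funext h)
  have hN' : (N:ℝ) ≠ 0 := by positivity
  have h1 : xiN N k i ^ 2 ≤ nsqV (xiN N k) :=
    Finset.single_le_sum (f := fun i => xiN N k i ^ 2) (fun _ _ => sq_nonneg _) (Finset.mem_univ i)
  have h2 : (N:ℝ)^2 * xiN N k i ^ 2 = (2 * π)^2 * (k i : ℝ)^2 := by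
    simp only [xiN]; field_simp
  have h3 : (1:ℝ) ≤ (k i : ℝ)^2 := by
    have : (1:ℤ) ≤ (k i)^2 := by
      have := sq_pos_of_ne_zero hi; omega
    exact_mod_cast this
  have h4 : (1:ℝ) ≤ (2 * π)^2 := by nlinarith [Real.pi_gt_three]
  calc (1:ℝ) ≤ (2 * π)^2 * (k i : ℝ)^2 := one_le_mul_of_one_le_of_one_le h4 h3
    _ = (N:ℝ)^2 * xiN N k i ^ 2 := h2.symm
    _ ≤ _ := by gcongr

lemma div_le_xi {N : ℕ} (hN : 0 < N) (k : Fin 3 → ℤ) {b : ℝ} (hb : 0 ≤ b) :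
    b / nsqV (xiN N k) ≤ (N:ℝ)^2 * b := by
  by_cases hk : k = 0
  · subst hk
    simp [nsqV, xiN]; positivity
  · have h := nsq_xi_lower hN k hk
    have hp : 0 < nsqV (xiN N k) := by
      rcases (nsqV_nonneg (xiN N k)).lt_or_eq with h' | h'
      · exact h'
      · rw [← h'] at h; norm_num at h
    rw [div_le_iff₀ hp]
    nlinarith

lemma dual_bound {N : ℕ} (hN : 0 < N) {f : V3 → ℝ} (hf : Continuous f) :
    Summable (fun k => Complex.normSq (fCoeffR N f (xiN N k)) / nsqV (xiN N k)) ∧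
    ∑' k, Complex.normSq (fCoeffR N f (xiN N k)) / nsqV (xiN N k)
      ≤ (N:ℝ)^2 * ((N:ℝ)^3 * ∫ x in cubeN N, f x ^ 2) := by
  obtain ⟨h1, h2⟩ := bessel_aux hN (f := fun x => ((f x : ℝ) : ℂ)) (Complex.continuous_ofReal.comp hf)
  have hs : Summable (fun k => Complex.normSq (fCoeffR N f (xiN N k)) / nsqV (xiN N k)) :=
    Summable.of_nonneg_of_le (fun k => div_nonneg (Complex.normSq_nonneg _) (nsqV_nonneg _))
      (fun k => div_le_xi hN k (Complex.normSq_nonneg _)) (h1.mul_left ((N:ℝ)^2))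
  refine ⟨hs, ?_⟩
  refine (hs.tsum_le_tsum (fun k => div_le_xi hN k (Complex.normSq_nonneg _))
    (h1.mul_left ((N:ℝ)^2))).trans ?_
  rw [tsum_mul_left]
  refine mul_le_mul_of_nonneg_left ?_ (by positivity)
  simpa [Complex.normSq_ofReal, ← sq, fCoeffR] using h2

lemma dualSum_eq (N : ℕ) (f : V3 → ℝ) :
    dualSum N f = ∑' k, Complex.normSq (fCoeffR N f (xiN N k)) / nsqV (xiN N k) := by
  unfold dualSum
  refine tsum_congr fun k => ?_
  split_ifs with h
  · subst h; simp [nsqV, xiN]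
  · rfl

lemma sigma1_cont {N : ℕ} {σ : V3 → ℝ} (hreg : ContDiff ℝ 2 σ) (r : V3) (κ : GammaIdx N → V3) :
    Continuous (sigma1F N σ r κ) := by
  unfold sigma1F dotP gradV
  refine (continuous_finsetSum _ fun n _ => continuous_finsetSum _ fun i _ => ?_).neg
  refine continuous_const.mul ?_
  exact ((hreg.continuous_fderiv (by norm_num)).comp
    ((continuous_id.sub continuous_const).sub continuous_const)).clm_apply continuous_const

/-- key upper bound -/
lemma T_up {N : ℕ} (hN : 0 < N) {σ : V3 → ℝ} (hreg : ContDiff ℝ 2 σ) (e Z α : ℝ)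
    (hZ : 0 < Z) (r : V3) (κ : GammaIdx N → V3) {φ : V3 → ℂ} (hφ : Continuous φ) :
    ∑' k, Complex.normSq (fCoeffR N (sigma1F N σ r κ) (xiN N k)) / nsqV (xiN N k)
      ≤ 2 * dualSum N (rho1F N σ e Z α r κ φ)
        + (8 * e^2 * Z * (N:ℝ)^5) * ∫ x in cubeN N, Complex.normSq (φ x) := by
  set g : V3 → ℝ := fun x => 2 * e * Real.sqrt Z * (Complex.exp (-Complex.I * (α : ℂ)) * φ x).re with hg
  have hgc : Continuous g := continuous_const.mul (Complex.continuous_re.comp (continuous_const.mul hφ))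
  have hsc := sigma1_cont hreg r κ
  have hrc : Continuous (rho1F N σ e Z α r κ φ) := hsc.sub hgc
  obtain ⟨s1, -⟩ := dual_bound hN hsc
  obtain ⟨s2, -⟩ := dual_bound hN hrc
  obtain ⟨s3, b3⟩ := dual_bound hN hgc
  have hlin : ∀ ξ, fCoeffR N (sigma1F N σ r κ) ξ
      = fCoeffR N (rho1F N σ e Z α r κ φ) ξ + fCoeffR N g ξ := by
    intro ξ
    have c1 : Continuous (fun x => ex ξ x * ((rho1F N σ e Z α r κ φ x : ℝ) : ℂ)) :=
      (ex_cont ξ).mul (Complex.continuous_ofReal.comp hrc)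
    have c2 : Continuous (fun x => ex ξ x * ((g x : ℝ) : ℂ)) :=
      (ex_cont ξ).mul (Complex.continuous_ofReal.comp hgc)
    simp only [fCoeffR, fCoeff_eq]
    rw [← integral_add (cubeN_int N c1) (cubeN_int N c2)]
    congr 1
    ext x
    rw [← mul_add, ← Complex.ofReal_add]
    congr 2
    simp only [rho1F, hg]; ring
  have hpt : ∀ k, Complex.normSq (fCoeffR N (sigma1F N σ r κ) (xiN N k)) / nsqV (xiN N k)
      ≤ 2 * (Complex.normSq (fCoeffR N (rho1F N σ e Z α r κ φ) (xiN N k)) / nsqV (xiN N k))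
        + 2 * (Complex.normSq (fCoeffR N g (xiN N k)) / nsqV (xiN N k)) := by
    intro k
    rw [← mul_div_assoc, ← mul_div_assoc, ← add_div]
    refine div_le_div_of_nonneg_right ?_ (nsqV_nonneg _)
    rw [hlin]
    simp only [Complex.normSq_apply, Complex.add_re, Complex.add_im]
    nlinarith [sq_nonneg ((fCoeffR N (rho1F N σ e Z α r κ φ) (xiN N k)).re - (fCoeffR N g (xiN N k)).re),
      sq_nonneg ((fCoeffR N (rho1F N σ e Z α r κ φ) (xiN N k)).im - (fCoeffR N g (xiN N k)).im)]
  have h1 := s1.tsum_le_tsum hpt ((s2.mul_left 2).add (s3.mul_left 2))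
  rw [(s2.mul_left 2).tsum_add (s3.mul_left 2), tsum_mul_left, tsum_mul_left,
    ← dualSum_eq N (rho1F N σ e Z α r κ φ)] at h1
  have h2 : ∫ x in cubeN N, g x ^ 2 ≤ (4 * e^2 * Z) * ∫ x in cubeN N, Complex.normSq (φ x) := by
    rw [← integral_const_mul]
    refine setIntegral_mono (cubeN_int N (hgc.pow 2)) (cubeN_int N (continuous_const.mul
      (Complex.continuous_normSq.comp hφ))) fun x => ?_
    have hn : ‖Complex.exp (-Complex.I * (α : ℂ))‖ = 1 := by
      rw [show -Complex.I * (α : ℂ) = ((-α : ℝ) : ℂ) * Complex.I by push_cast; ring]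
      exact Complex.norm_exp_ofReal_mul_I _
    have h3 : (Complex.exp (-Complex.I * (α : ℂ)) * φ x).re ^ 2 ≤ Complex.normSq (φ x) := by
      have := Complex.abs_re_le_norm (Complex.exp (-Complex.I * (α : ℂ)) * φ x)
      rw [norm_mul, hn, one_mul] at this
      rw [Complex.normSq_eq_norm_sq, ← sq_abs]
      exact pow_le_pow_left₀ (abs_nonneg _) this 2
    simp only [hg]
    rw [mul_pow, mul_pow, mul_pow, Real.sq_sqrt hZ.le]
    have : 0 ≤ 4 * e^2 * Z := by positivity
    nlinarith [mul_le_mul_of_nonneg_left h3 this]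
  have h4 : (N:ℝ)^2 * ((N:ℝ)^3 * ∫ x in cubeN N, g x ^ 2)
      ≤ (N:ℝ)^2 * ((N:ℝ)^3 * ((4 * e^2 * Z) * ∫ x in cubeN N, Complex.normSq (φ x))) := by gcongr
  calc _ ≤ _ := h1
    _ ≤ 2 * dualSum N (rho1F N σ e Z α r κ φ) + 2 * ((N:ℝ)^2 * ((N:ℝ)^3 *
        ((4 * e^2 * Z) * ∫ x in cubeN N, Complex.normSq (φ x)))) := by
        have := b3.trans h4
        linarith
    _ = _ := by ring

/-- positivity of the energy Hessian with a spectral gap. -/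
theorem stmt9 (N : ℕ) (hN : 0 < N) (σ : V3 → ℝ) (e Z M : ℝ)
    (he : 0 < e) (hZ : 0 < Z) (hM : 0 < M)
    (hper : IsPerN N σ) (hreg : ContDiff ℝ 2 σ)
    (hint : (∫ x in cubeN N, σ x) = e * Z)
    (hJ : JelliumCond N σ) (hW : WienerCond N σ) :
    ∃ ν > (0 : ℝ), ∀ (α : ℝ) (r : V3) (φ : V3 → ℂ) (κ p : GammaIdx N → V3),
      IsPerN N φ → ContDiff ℝ 1 φ →
      (∫ x in cubeN N, φ x) = 0 →
      (∑ n : GammaIdx N, κ n) = 0 →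
      BformQ N σ e Z M α r φ κ p ≥
        ν * ((∫ x in cubeN N, (Complex.normSq (φ x) + gradSq φ x))
          + (∑ n : GammaIdx N, nsqV (κ n)) + ∑ n : GammaIdx N, nsqV (p n)) := by
  obtain ⟨c, hc, hlow⟩ := T_low hN hreg.continuous hW
  have hNp : (0:ℝ) < N := by exact_mod_cast hN
  set C1 : ℝ := 3 * (N:ℝ)^2 with hC1
  set C2 : ℝ := 8 * e^2 * Z * (N:ℝ)^5 with hC2
  set A : ℝ := C1 + 1 + C2 * C1 / c with hA
  have hC1p : 0 < C1 := by positivity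
  have hC2p : 0 < C2 := by positivity
  have hAp : 0 < A := by positivity
  set ν : ℝ := min (1 / 2 / A) (min ((2 * (N:ℝ)^3)⁻¹ * (c / 2)) (2 * M)⁻¹) with hν
  have hνp : 0 < ν := by
    refine lt_min (by positivity) (lt_min (by positivity) (by positivity))
  have n1 : ν * A ≤ 1 / 2 := by
    rw [← le_div_iff₀ hAp]; exact min_le_left _ _
  have n2 : ν * (2 / c) ≤ (2 * (N:ℝ)^3)⁻¹ := by
    have : ν ≤ (2 * (N:ℝ)^3)⁻¹ * (c / 2) := (min_le_right _ _).trans (min_le_left _ _)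
    calc ν * (2 / c) ≤ (2 * (N:ℝ)^3)⁻¹ * (c / 2) * (2 / c) := by gcongr
      _ = _ := by field_simp
  have n3 : ν ≤ (2 * M)⁻¹ := (min_le_right _ _).trans (min_le_right _ _)
  refine ⟨ν, hνp, fun α r φ κ p hφ hφc hφ0 hκ => ?_⟩
  have hP := poincare hN hφ hφc hφ0
  have hT := T_up hN hreg e Z α hZ r κ hφc.continuous
  have hL := hlow κ hκ _ (fun k => ?_) (dual_bound hN (sigma1_cont hreg r κ)).1
  swap
  · rw [fCoeff_sigma1 hN hper hreg]
    simp only [map_mul, Complex.normSq_I, one_mul]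
    rw [Complex.normSq_eq_norm_sq (ex _ _), ex_norm]
    ring
  have hsplit : ∫ x in cubeN N, (Complex.normSq (φ x) + gradSq φ x)
      = (∫ x in cubeN N, Complex.normSq (φ x)) + ∫ x in cubeN N, gradSq φ x :=
    integral_add (cubeN_int N (Complex.continuous_normSq.comp hφc.continuous))
      (cubeN_int N (gradSq_cont hφc))
  have hS0 : 0 ≤ ∫ x in cubeN N, gradSq φ x :=
    integral_nonneg fun x => Finset.sum_nonneg fun _ _ => Complex.normSq_nonneg _
  have hD0 : 0 ≤ dualSum N (rho1F N σ e Z α r κ φ) := by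
    rw [dualSum_eq]
    exact tsum_nonneg fun k => div_nonneg (Complex.normSq_nonneg _) (nsqV_nonneg _)
  have hp0 : 0 ≤ ∑ n, nsqV (p n) := Finset.sum_nonneg fun _ _ => nsqV_nonneg _
  rw [hsplit]
  unfold BformQ
  set S := ∫ x in cubeN N, gradSq φ x
  set P := ∫ x in cubeN N, Complex.normSq (φ x)
  set D := dualSum N (rho1F N σ e Z α r κ φ)
  set K := ∑ n, nsqV (κ n)
  set Q := ∑ n, nsqV (p n)
  have hK : K ≤ 2 / c * D + C2 * C1 / c * S := by
    have h5 : c * K ≤ 2 * D + C2 * (C1 * S) :=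
      (hL.trans hT).trans (by gcongr)
    have : K ≤ (2 * D + C2 * (C1 * S)) / c := by
      rw [le_div_iff₀ hc]; linarith
    refine this.trans (le_of_eq ?_)
    field_simp
  have f1 : P + S + K ≤ A * S + 2 / c * D := by
    rw [hA]; linarith
  have f2 : ν * (P + S + K) ≤ ν * (A * S + 2 / c * D) := by gcongr
  have f3 := mul_le_mul_of_nonneg_right n1 hS0
  have f4 := mul_le_mul_of_nonneg_right n2 hD0
  have f5 := mul_le_mul_of_nonneg_right n3 hp0
  have : ν * (P + S + K + Q) = ν * (P + S + K) + ν * Q := by ring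
  rw [ge_iff_le, this]
  linarith

end SPN
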